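/- Let f₀ : 𝒳ⁿ → ℝⁿ be Lipschitz on bounded sets with f₀(0) = 0, and suppose f₀ is Fréchet differentiable at the origin with Fréchet derivative the bounded linear operator A : 𝒳ⁿ → ℝⁿ, i.e., |f₀(φ) − Aφ| / ‖φ‖ → 0 as ‖φ‖ → 0⁺. Then the origin of the nonlinear system ẋ(t) = f₀(x_t) is ES if and only if the origin of the linear system ẋ(t) = A x_t is AS. -/

import Mathlib

open Set Filter MeasureTheory Topology
open scoped NNReal

noncomputable section

/-- `ℝⁿ` with the Euclidean norm. -/
abbrev Vec (n : ℕ) : Type := EuclideanSpace ℝ (Fin n)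

/-- The state space `𝒳ⁿ = C([-Δ,0], ℝⁿ)`, equipped with the sup norm. -/
abbrev Hist (Δ : ℝ≥0) (n : ℕ) : Type :=
  ContinuousMap (Icc (-(Δ : ℝ)) (0 : ℝ)) (Vec n)

theorem zero_mem_IccD (Δ : ℝ≥0) : (0 : ℝ) ∈ Icc (-(Δ : ℝ)) (0 : ℝ) :=
  ⟨neg_nonpos.mpr Δ.coe_nonneg, le_refl 0⟩

/-- `φ(0)`: the current value of a history segment. -/
def ev0 {Δ : ℝ≥0} {n : ℕ} (φ : Hist Δ n) : Vec n :=
  φ ⟨0, zero_mem_IccD Δ⟩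

/-! ### Comparison functions -/

/-- Class `𝒦`: continuous, strictly increasing, zero at zero (on `[0,∞)`). -/
def ClassK (α : ℝ → ℝ) : Prop :=
  ContinuousOn α (Ici 0) ∧ StrictMonoOn α (Ici 0) ∧ α 0 = 0

/-- Class `𝒦∞`: class `𝒦` and unbounded. -/
def ClassKinf (α : ℝ → ℝ) : Prop :=
  ClassK α ∧ Tendsto α atTop atTop

/-- Class `𝒩`: continuous, nondecreasing, zero at zero (on `[0,∞)`). -/
def ClassN (α : ℝ → ℝ) : Prop :=
  ContinuousOn α (Ici 0) ∧ MonotoneOn α (Ici 0) ∧ α 0 = 0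

/-- Class `𝒫`: continuous, zero at zero, positive on `(0,∞)`. -/
def ClassP (α : ℝ → ℝ) : Prop :=
  ContinuousOn α (Ici 0) ∧ α 0 = 0 ∧ ∀ s : ℝ, 0 < s → 0 < α s

/-- Class `𝒦ℒ`. -/
def ClassKL (β : ℝ → ℝ → ℝ) : Prop :=
  (∀ t : ℝ, 0 ≤ t → ClassK fun s => β s t) ∧
    ∀ s : ℝ, 0 ≤ s →
      ContinuousOn (β s) (Ici 0) ∧ AntitoneOn (β s) (Ici 0) ∧
        Tendsto (β s) atTop (𝓝 0)

/-! ### Inputs -/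

/-- Admissible input: Lebesgue measurable and locally essentially bounded. -/
def IsInput {m : ℕ} (u : ℝ → Vec m) : Prop :=
  Measurable u ∧ ∀ T : ℝ, 0 < T → ∃ C : ℝ, ∀ᵐ t ∂volume, t ∈ Icc (0 : ℝ) T → ‖u t‖ ≤ C

/-- Essential supremum of `‖u‖` over a set of times. -/
def essBnd {m : ℕ} (u : ℝ → Vec m) (s : Set ℝ) : ℝ :=
  sInf {C : ℝ | 0 ≤ C ∧ ∀ᵐ τ ∂volume, τ ∈ s → ‖u τ‖ ≤ C}

/-! ### History segments along a trajectory -/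

-- The history segment `x_t ∈ 𝒳ⁿ` of a trajectory `x : ℝ → ℝⁿ` (with junk value `0`
-- when `x` is not continuous on `[t-Δ, t]`).
open Classical in
def seg (Δ : ℝ≥0) {n : ℕ} (x : ℝ → Vec n) (t : ℝ) : Hist Δ n :=
  if hx : ContinuousOn x (Icc (t - (Δ : ℝ)) t) then
    { toFun := fun τ => x (t + τ.1)
      continuous_toFun := by
        have h1 : Continuous fun τ : Icc (-(Δ : ℝ)) (0 : ℝ) => t + τ.1 :=
          continuous_const.add continuous_subtype_val
        have h2 : ∀ τ : Icc (-(Δ : ℝ)) (0 : ℝ), t + τ.1 ∈ Icc (t - (Δ : ℝ)) t := by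
          rintro ⟨τ, hτ⟩
          rw [mem_Icc] at hτ ⊢
          constructor
          · linarith [hτ.1]
          · linarith [hτ.2]
        exact hx.comp_continuous h1 h2 }
  else 0

/-! ### Driver's derivative and Dini derivative -/

/-- The deformed history `φ_{h,w}` appearing in Driver's derivative: for `0 ≤ h < Δ`,
`φ_{h,w}(s) = φ(s+h)` for `s ∈ [-Δ,-h)` and `φ_{h,w}(s) = φ(0) + w(h+s)` for `s ∈ [-h,0]`. -/
def shiftSeg {Δ : ℝ≥0} {n : ℕ} (φ : Hist Δ n) (w : Vec n) (h : ℝ) : Hist Δ n :=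
  { toFun := fun s =>
      φ (projIcc (-(Δ : ℝ)) 0 (neg_nonpos.mpr Δ.coe_nonneg) (s.1 + h)) + max (h + s.1) 0 • w
    continuous_toFun := by
      refine Continuous.add ?_ ?_
      · exact φ.continuous.comp (continuous_projIcc.comp
          (continuous_subtype_val.add continuous_const))
      · exact ((continuous_const.add continuous_subtype_val).max continuous_const).smul
          continuous_const }

/-- Driver's derivative `D⁺V(φ,w)`, valued in the extended reals. -/
def driverD {Δ : ℝ≥0} {n : ℕ} (V : Hist Δ n → ℝ) (φ : Hist Δ n) (w : Vec n) : EReal :=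
  limsup (fun h : ℝ => (((V (shiftSeg φ w h) - V φ) / h : ℝ) : EReal)) (𝓝[>] (0 : ℝ))

/-- Upper right-hand Dini derivative of `ν : ℝ → ℝ`, valued in the extended reals. -/
def diniD (ν : ℝ → ℝ) (t : ℝ) : EReal :=
  limsup (fun h : ℝ => (((ν (t + h) - ν t) / h : ℝ) : EReal)) (𝓝[>] (0 : ℝ))

/-! ### Lipschitz conditions -/

/-- `f : 𝒳ⁿ × ℝᵐ → ℝⁿ` is Lipschitz on bounded sets. -/
def LipOnBounded {Δ : ℝ≥0} {n m : ℕ} (f : Hist Δ n → Vec m → Vec n) : Prop :=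
  ∀ r : ℝ, 0 < r → ∃ L : ℝ, 0 < L ∧
    ∀ (φ₁ φ₂ : Hist Δ n) (v₁ v₂ : Vec m),
      ‖φ₁‖ ≤ r → ‖φ₂‖ ≤ r → ‖v₁‖ ≤ r → ‖v₂‖ ≤ r →
        ‖f φ₁ v₁ - f φ₂ v₂‖ ≤ L * (‖φ₁ - φ₂‖ + ‖v₁ - v₂‖)

/-- An input-free vector field `f₀ : 𝒳ⁿ → ℝⁿ` Lipschitz on bounded sets. -/
def LipOnBounded₀ {Δ : ℝ≥0} {n : ℕ} (f₀ : Hist Δ n → Vec n) : Prop :=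
  ∀ r : ℝ, 0 < r → ∃ L : ℝ, 0 < L ∧
    ∀ φ₁ φ₂ : Hist Δ n, ‖φ₁‖ ≤ r → ‖φ₂‖ ≤ r → ‖f₀ φ₁ - f₀ φ₂‖ ≤ L * ‖φ₁ - φ₂‖

/-- A functional `V : 𝒳ⁿ → ℝ` Lipschitz on bounded sets. -/
def LipOnBoundedV {Δ : ℝ≥0} {n : ℕ} (V : Hist Δ n → ℝ) : Prop :=
  ∀ r : ℝ, 0 < r → ∃ L : ℝ, 0 < L ∧
    ∀ φ₁ φ₂ : Hist Δ n, ‖φ₁‖ ≤ r → ‖φ₂‖ ≤ r → |V φ₁ - V φ₂| ≤ L * ‖φ₁ - φ₂‖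

/-- A functional `V : 𝒳ⁿ → ℝ` locally Lipschitz. -/
def LocallyLipV {Δ : ℝ≥0} {n : ℕ} (V : Hist Δ n → ℝ) : Prop :=
  ∀ φ : Hist Δ n, ∃ δ : ℝ, 0 < δ ∧ ∃ L : ℝ, 0 < L ∧
    ∀ φ₁ φ₂ : Hist Δ n, ‖φ₁ - φ‖ ≤ δ → ‖φ₂ - φ‖ ≤ δ → |V φ₁ - V φ₂| ≤ L * ‖φ₁ - φ₂‖

/-! ### Solutions -/

/-- `x` is a solution of `ẋ(t) = f(x_t, u(t))` with initial state `x₀` on `[0, tmax)`. -/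
structure IsSolution (Δ : ℝ≥0) {n m : ℕ} (f : Hist Δ n → Vec m → Vec n)
    (u : ℝ → Vec m) (x₀ : Hist Δ n) (tmax : EReal) (x : ℝ → Vec n) : Prop where
  tmax_pos : 0 < tmax
  cont : ContinuousOn x {s : ℝ | -(Δ : ℝ) ≤ s ∧ (s : EReal) < tmax}
  init : ∀ τ : Icc (-(Δ : ℝ)) (0 : ℝ), x τ.1 = x₀ τ
  integrable : ∀ t : ℝ, 0 ≤ t → (t : EReal) < tmax →
    IntervalIntegrable (fun s => f (seg Δ x s) (u s)) volume 0 t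
  integral_eq : ∀ t : ℝ, 0 ≤ t → (t : EReal) < tmax →
    x t = x 0 + ∫ s in (0:ℝ)..t, f (seg Δ x s) (u s)

/-- Maximal solution: a solution admitting no proper extension. -/
def IsMaxSolution (Δ : ℝ≥0) {n m : ℕ} (f : Hist Δ n → Vec m → Vec n)
    (u : ℝ → Vec m) (x₀ : Hist Δ n) (tmax : EReal) (x : ℝ → Vec n) : Prop :=
  IsSolution Δ f u x₀ tmax x ∧
    ∀ (tmax' : EReal) (x' : ℝ → Vec n), IsSolution Δ f u x₀ tmax' x' →
      (∀ t : ℝ, -(Δ : ℝ) ≤ t → (t : EReal) < tmax → x' t = x t) → tmax' ≤ tmax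

/-- Solution of the input-free system `ẋ(t) = f₀(x_t)`. -/
def IsSolution₀ (Δ : ℝ≥0) {n : ℕ} (f₀ : Hist Δ n → Vec n) (x₀ : Hist Δ n)
    (tmax : EReal) (x : ℝ → Vec n) : Prop :=
  IsSolution Δ (fun φ (_ : Vec 0) => f₀ φ) (fun _ => 0) x₀ tmax x

/-- Maximal solution of the input-free system `ẋ(t) = f₀(x_t)`. -/
def IsMaxSolution₀ (Δ : ℝ≥0) {n : ℕ} (f₀ : Hist Δ n → Vec n) (x₀ : Hist Δ n)
    (tmax : EReal) (x : ℝ → Vec n) : Prop :=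
  IsMaxSolution Δ (fun φ (_ : Vec 0) => f₀ φ) (fun _ => 0) x₀ tmax x

/-! ### Stability properties (input-free systems) -/

/-- Global asymptotic stability (GAS). -/
def GAS (Δ : ℝ≥0) {n : ℕ} (f₀ : Hist Δ n → Vec n) : Prop :=
  ∃ β : ℝ → ℝ → ℝ, ClassKL β ∧
    ∀ (x₀ : Hist Δ n) (tmax : EReal) (x : ℝ → Vec n),
      IsMaxSolution₀ Δ f₀ x₀ tmax x →
        tmax = ⊤ ∧ ∀ t : ℝ, 0 ≤ t → ‖x t‖ ≤ β ‖x₀‖ t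

/-- Global exponential stability (GES). -/
def GES (Δ : ℝ≥0) {n : ℕ} (f₀ : Hist Δ n → Vec n) : Prop :=
  ∃ k : ℝ, 1 ≤ k ∧ ∃ lam : ℝ, 0 < lam ∧
    ∀ (x₀ : Hist Δ n) (tmax : EReal) (x : ℝ → Vec n),
      IsMaxSolution₀ Δ f₀ x₀ tmax x →
        tmax = ⊤ ∧ ∀ t : ℝ, 0 ≤ t → ‖x t‖ ≤ k * ‖x₀‖ * Real.exp (-lam * t)

/-- (Local) asymptotic stability (AS) of the origin. -/
def AS (Δ : ℝ≥0) {n : ℕ} (f₀ : Hist Δ n → Vec n) : Prop :=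
  ∃ r : ℝ, 0 < r ∧ ∃ β : ℝ → ℝ → ℝ, ClassKL β ∧
    ∀ (x₀ : Hist Δ n) (tmax : EReal) (x : ℝ → Vec n),
      IsMaxSolution₀ Δ f₀ x₀ tmax x → ‖x₀‖ ≤ r →
        tmax = ⊤ ∧ ∀ t : ℝ, 0 ≤ t → ‖x t‖ ≤ β ‖x₀‖ t

/-- (Local) exponential stability (ES) of the origin. -/
def ES (Δ : ℝ≥0) {n : ℕ} (f₀ : Hist Δ n → Vec n) : Prop :=
  ∃ r : ℝ, 0 < r ∧ ∃ k : ℝ, 1 ≤ k ∧ ∃ lam : ℝ, 0 < lam ∧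
    ∀ (x₀ : Hist Δ n) (tmax : EReal) (x : ℝ → Vec n),
      IsMaxSolution₀ Δ f₀ x₀ tmax x → ‖x₀‖ ≤ r →
        tmax = ⊤ ∧ ∀ t : ℝ, 0 ≤ t → ‖x t‖ ≤ k * ‖x₀‖ * Real.exp (-lam * t)

/-! ### Forward completeness -/

/-- Robust forward completeness (RFC) of `ẋ(t) = f(x_t,u(t))`. -/
def RFC (Δ : ℝ≥0) {n m : ℕ} (f : Hist Δ n → Vec m → Vec n) : Prop :=
  (∀ (x₀ : Hist Δ n) (u : ℝ → Vec m) (tmax : EReal) (x : ℝ → Vec n),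
      IsInput u → IsMaxSolution Δ f u x₀ tmax x → tmax = ⊤) ∧
    ∀ T : ℝ, 0 < T → ∀ r : ℝ, 0 < r → ∃ C : ℝ,
      ∀ (x₀ : Hist Δ n) (u : ℝ → Vec m) (tmax : EReal) (x : ℝ → Vec n),
        IsInput u → IsMaxSolution Δ f u x₀ tmax x →
          ‖x₀‖ ≤ r → essBnd u (Ici 0) ≤ r →
            ∀ t : ℝ, t ∈ Icc (0 : ℝ) T → ‖seg Δ x t‖ ≤ C

/-- Robust forward completeness of the input-free system `ẋ(t) = f₀(x_t)`. -/
def RFC₀ (Δ : ℝ≥0) {n : ℕ} (f₀ : Hist Δ n → Vec n) : Prop :=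
  RFC Δ (fun φ (_ : Vec 0) => f₀ φ)

/-! ### Input-to-state stability notions -/

/-- Input-to-state stability (ISS). -/
def ISS (Δ : ℝ≥0) {n m : ℕ} (f : Hist Δ n → Vec m → Vec n) : Prop :=
  ∃ β : ℝ → ℝ → ℝ, ∃ μ : ℝ → ℝ, ClassKL β ∧ ClassN μ ∧
    ∀ (x₀ : Hist Δ n) (u : ℝ → Vec m) (tmax : EReal) (x : ℝ → Vec n),
      IsInput u → IsMaxSolution Δ f u x₀ tmax x →
        tmax = ⊤ ∧ ∀ t : ℝ, 0 ≤ t → ‖x t‖ ≤ β ‖x₀‖ t + μ (essBnd u (Icc 0 t))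

/-- Local input-to-state stability (LISS). -/
def LISS (Δ : ℝ≥0) {n m : ℕ} (f : Hist Δ n → Vec m → Vec n) : Prop :=
  ∃ r : ℝ, 0 < r ∧ ∃ β : ℝ → ℝ → ℝ, ∃ μ : ℝ → ℝ, ClassKL β ∧ ClassN μ ∧
    ∀ (x₀ : Hist Δ n) (u : ℝ → Vec m) (tmax : EReal) (x : ℝ → Vec n),
      IsInput u → IsMaxSolution Δ f u x₀ tmax x →
        ‖x₀‖ ≤ r → essBnd u (Ici 0) ≤ r →
          tmax = ⊤ ∧ ∀ t : ℝ, 0 ≤ t → ‖x t‖ ≤ β ‖x₀‖ t + μ (essBnd u (Icc 0 t))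

/-- Integral input-to-state stability (iISS). -/
def iISS (Δ : ℝ≥0) {n m : ℕ} (f : Hist Δ n → Vec m → Vec n) : Prop :=
  ∃ β : ℝ → ℝ → ℝ, ∃ η μ : ℝ → ℝ, ClassKL β ∧ ClassN η ∧ ClassN μ ∧
    ∀ (x₀ : Hist Δ n) (u : ℝ → Vec m) (tmax : EReal) (x : ℝ → Vec n),
      IsInput u → IsMaxSolution Δ f u x₀ tmax x →
        tmax = ⊤ ∧ ∀ t : ℝ, 0 ≤ t →
          ‖x t‖ ≤ β ‖x₀‖ t + η (∫ s in (0:ℝ)..t, μ ‖u s‖)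

/-- The UBEBS estimate with offset `c`. -/
def UBEBSwith (Δ : ℝ≥0) {n m : ℕ} (f : Hist Δ n → Vec m → Vec n) (c : ℝ) : Prop :=
  ∃ α ξ ζ : ℝ → ℝ, ClassKinf α ∧ ClassKinf ξ ∧ ClassKinf ζ ∧
    ∀ (x₀ : Hist Δ n) (u : ℝ → Vec m) (tmax : EReal) (x : ℝ → Vec n),
      IsInput u → IsMaxSolution Δ f u x₀ tmax x →
        tmax = ⊤ ∧ ∀ t : ℝ, 0 ≤ t →
          α ‖x t‖ ≤ ξ ‖x₀‖ + (∫ s in (0:ℝ)..t, ζ ‖u s‖) + c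

/-! ### Lyapunov–Krasovskii functionals -/

/-- Lyapunov–Krasovskii functional candidate (LKF). -/
def IsLKF {Δ : ℝ≥0} {n : ℕ} (V : Hist Δ n → ℝ) : Prop :=
  (∀ φ, 0 ≤ V φ) ∧ LipOnBoundedV V ∧
    ∃ α₁ α₂ : ℝ → ℝ, ClassKinf α₁ ∧ ClassKinf α₂ ∧
      ∀ φ : Hist Δ n, α₁ ‖ev0 φ‖ ≤ V φ ∧ V φ ≤ α₂ ‖φ‖

/-- Coercive Lyapunov–Krasovskii functional candidate. -/
def IsCoerciveLKF {Δ : ℝ≥0} {n : ℕ} (V : Hist Δ n → ℝ) : Prop :=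
  (∀ φ, 0 ≤ V φ) ∧ LipOnBoundedV V ∧
    ∃ α₁ α₂ : ℝ → ℝ, ClassKinf α₁ ∧ ClassKinf α₂ ∧
      ∀ φ : Hist Δ n, α₁ ‖φ‖ ≤ V φ ∧ V φ ≤ α₂ ‖φ‖

end

/-! ### History segments of continuous functions -/

section Segments

variable {Δ : ℝ≥0} {n : ℕ}

theorem seg_apply {x : ℝ → Vec n} (hx : Continuous x) (t : ℝ)
    (τ : Icc (-(Δ : ℝ)) (0 : ℝ)) : seg Δ x t τ = x (t + τ) := by
  simp only [seg, dif_pos hx.continuousOn, ContinuousMap.coe_mk]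

theorem seg_congr {x y : ℝ → Vec n} {t : ℝ} (h : EqOn x y (Icc (t - Δ) t)) :
    seg Δ x t = seg Δ y t := by
  by_cases hx : ContinuousOn x (Icc (t - Δ) t)
  · have hy : ContinuousOn y (Icc (t - Δ) t) := (continuousOn_congr h).1 hx
    ext1 τ
    simp only [seg, dif_pos hx, dif_pos hy, ContinuousMap.coe_mk]
    exact h ⟨by linarith [τ.2.1], by linarith [τ.2.2]⟩
  · have hy : ¬ ContinuousOn y (Icc (t - Δ) t) := fun hy => hx ((continuousOn_congr h).2 hy)
    simp only [seg, dif_neg hx, dif_neg hy]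

theorem continuous_seg {x : ℝ → Vec n} (hx : Continuous x) : Continuous (seg Δ x) := by
  let F : C(ℝ × Icc (-(Δ : ℝ)) (0 : ℝ), Vec n) := ⟨fun p => x (p.1 + p.2), by fun_prop⟩
  have h : seg Δ x = F.curry := by
    ext1 t
    ext1 τ
    rw [seg_apply hx]
    rfl
  rw [h]
  exact F.curry.continuous

theorem norm_seg_le {x : ℝ → Vec n} (hx : Continuous x) {t a : ℝ} (ha : 0 ≤ a)
    (h : ∀ s ∈ Icc (t - Δ) t, ‖x s‖ ≤ a) : ‖seg Δ x t‖ ≤ a := by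
  rw [ContinuousMap.norm_le _ ha]
  intro τ
  rw [seg_apply hx]
  exact h _ ⟨by linarith [τ.2.1], by linarith [τ.2.2]⟩

theorem norm_le_norm_seg {x : ℝ → Vec n} (hx : Continuous x) {s t : ℝ}
    (hs : s ∈ Icc (t - Δ) t) : ‖x s‖ ≤ ‖seg Δ x t‖ := by
  have h := (seg Δ x t).norm_coe_le_norm ⟨s - t, by linarith [hs.1], by linarith [hs.2]⟩
  rwa [seg_apply hx, add_sub_cancel] at h

theorem norm_apply_le_norm_seg {x : ℝ → Vec n} (hx : Continuous x) (t : ℝ) :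
    ‖x t‖ ≤ ‖seg Δ x t‖ :=
  norm_le_norm_seg hx ⟨by linarith [Δ.coe_nonneg], le_rfl⟩

theorem seg_sub {x y : ℝ → Vec n} (hx : Continuous x) (hy : Continuous y) (t : ℝ) :
    seg Δ (fun s => x s - y s) t = seg Δ x t - seg Δ y t := by
  ext1 τ
  rw [seg_apply (by fun_prop), ContinuousMap.sub_apply, seg_apply hx, seg_apply hy]

theorem seg_const_smul {x : ℝ → Vec n} (hx : Continuous x) (c t : ℝ) :
    seg Δ (fun s => c • x s) t = c • seg Δ x t := by
  ext1 τ
  rw [seg_apply (by fun_prop), ContinuousMap.smul_apply, seg_apply hx]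

theorem seg_shift {x : ℝ → Vec n} (hx : Continuous x) (T t : ℝ) :
    seg Δ (fun s => x (T + s)) t = seg Δ x (T + t) := by
  ext1 τ
  rw [seg_apply (by fun_prop), seg_apply hx, add_assoc]

/-- Grönwall's inequality for history segments. -/
theorem norm_seg_le_mul_exp_of_norm_le_integral {e : ℝ → Vec n} (he : Continuous e) {a K T : ℝ}
    (ha : 0 ≤ a) (hK : 0 ≤ K) (hinit : ∀ s ∈ Icc (-(Δ : ℝ)) 0, ‖e s‖ ≤ a)
    (h : ∀ t ∈ Icc 0 T, ‖e t‖ ≤ a + K * ∫ s in (0 : ℝ)..t, ‖seg Δ e s‖) :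
    ∀ t ∈ Icc 0 T, ‖seg Δ e t‖ ≤ a * Real.exp (K * t) := by
  have hu : Continuous fun s => ‖seg Δ e s‖ := (continuous_seg he).norm
  set F : ℝ → ℝ := fun t => a + K * ∫ s in (0 : ℝ)..t, ‖seg Δ e s‖ with hF
  have hderiv (t : ℝ) : HasDerivAt F (K * ‖seg Δ e t‖) t :=
    ((hu.integral_hasStrictDerivAt 0 t).hasDerivAt.const_mul K).const_add a
  have hnonneg (t : ℝ) (ht : 0 ≤ t) : 0 ≤ ∫ s in (0 : ℝ)..t, ‖seg Δ e s‖ :=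
    intervalIntegral.integral_nonneg ht fun _ _ => norm_nonneg _
  have hF0 (t : ℝ) (ht : 0 ≤ t) : 0 ≤ F t := add_nonneg ha (mul_nonneg hK (hnonneg t ht))
  have hle : ∀ t ∈ Icc 0 T, ‖seg Δ e t‖ ≤ F t := by
    intro t ht
    refine norm_seg_le he (hF0 t ht.1) fun s hs => ?_
    rcases le_total s 0 with hs0 | hs0
    · exact (hinit s ⟨by linarith [hs.1, ht.1], hs0⟩).trans
        (le_add_of_nonneg_right (mul_nonneg hK (hnonneg t ht.1)))
    · refine (h s ⟨hs0, hs.2.trans ht.2⟩).trans ?_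
      simp only [hF]
      gcongr
      exact intervalIntegral.integral_mono_interval le_rfl hs0 hs.2
        (Eventually.of_forall fun _ => norm_nonneg _) (hu.intervalIntegrable _ _)
  intro t ht
  have hgron := norm_le_gronwallBound_of_norm_deriv_right_le (f := F) (δ := a) (K := K) (ε := 0)
    (a := 0) (b := T) (fun s _ => (hderiv s).continuousAt.continuousWithinAt)
    (fun s _ => (hderiv s).hasDerivWithinAt) (by simp [hF, abs_of_nonneg ha])
    (fun s hs => by
      rw [add_zero, Real.norm_of_nonneg (by positivity), Real.norm_of_nonneg (hF0 s hs.1)]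
      exact mul_le_mul_of_nonneg_left (hle s ⟨hs.1, hs.2.le⟩) hK) t ht
  rw [gronwallBound_ε0, sub_zero] at hgron
  exact (hle t ht).trans ((Real.le_norm_self _).trans hgron)

end Segments

/-! ### Solutions on a compact time interval -/

/-- `x` is a continuous function on `ℝ` which solves `ẋ(t) = g(x_t)` on `[0, T]` with initial
state `φ`. -/
structure IsSolOn {Δ : ℝ≥0} {n : ℕ} (g : Hist Δ n → Vec n) (φ : Hist Δ n) (T : ℝ)
    (x : ℝ → Vec n) : Prop where
  cont : Continuous x
  init : ∀ τ : Icc (-(Δ : ℝ)) (0 : ℝ), x τ = φ τ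
  integral_eq : ∀ t ∈ Icc 0 T, x t = x 0 + ∫ s in (0 : ℝ)..t, g (seg Δ x s)

section Solutions

variable {Δ : ℝ≥0} {n : ℕ} {f g : Hist Δ n → Vec n} {φ : Hist Δ n} {T : ℝ} {x y : ℝ → Vec n}

namespace IsSolOn

theorem seg_zero (h : IsSolOn g φ T x) : seg Δ x 0 = φ := by
  ext1 τ
  rw [seg_apply h.cont, zero_add, h.init]

theorem norm_init_le (h : IsSolOn g φ T x) {s : ℝ} (hs : s ∈ Icc (-(Δ : ℝ)) 0) :
    ‖x s‖ ≤ ‖φ‖ := by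
  rw [h.init ⟨s, hs⟩]
  exact φ.norm_coe_le_norm _

theorem congr_field (h : IsSolOn g φ T x) (hfg : ∀ t ∈ Icc 0 T, f (seg Δ x t) = g (seg Δ x t)) :
    IsSolOn f φ T x := by
  refine ⟨h.cont, h.init, fun t ht => ?_⟩
  rw [h.integral_eq t ht]
  congr 1
  refine intervalIntegral.integral_congr fun s hs => ?_
  rw [uIcc_of_le ht.1] at hs
  exact (hfg s ⟨hs.1, hs.2.trans ht.2⟩).symm

theorem shift (h : ∀ T, IsSolOn g φ T x) (hg : Continuous g) {S : ℝ} (hS : 0 ≤ S) (T : ℝ) :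
    IsSolOn g (seg Δ x S) T fun t => x (S + t) := by
  have hx := (h 0).cont
  refine ⟨by fun_prop, fun τ => (seg_apply hx S τ).symm, fun t ht => ?_⟩
  have hint (a b : ℝ) : IntervalIntegrable (fun s => g (seg Δ x s)) volume a b :=
    (hg.comp (continuous_seg hx)).intervalIntegrable a b
  have hsub : ∫ s in (0 : ℝ)..t, g (seg Δ (fun r => x (S + r)) s)
      = ∫ s in S..S + t, g (seg Δ x s) := by
    simp only [seg_shift hx S]
    rw [intervalIntegral.integral_comp_add_left (fun s => g (seg Δ x s)), add_zero]
  rw [hsub, (h (S + t)).integral_eq (S + t) ⟨by linarith [ht.1], le_rfl⟩, add_zero,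
    (h S).integral_eq S ⟨hS, le_rfl⟩, add_assoc,
    intervalIntegral.integral_add_adjacent_intervals (hint _ _) (hint _ _)]

theorem const_smul {A : Hist Δ n →L[ℝ] Vec n} (h : IsSolOn (fun ψ => A ψ) φ T x) (c : ℝ) :
    IsSolOn (fun ψ => A ψ) (c • φ) T fun t => c • x t := by
  have hx := h.cont
  refine ⟨by fun_prop, fun τ => by rw [h.init, ContinuousMap.smul_apply], fun t ht => ?_⟩
  simp only [seg_const_smul hx, map_smul]
  rw [intervalIntegral.integral_smul, ← smul_add, ← h.integral_eq t ht]

/-- Two solutions of (possibly) different equations with the same initial state stay close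
when the fields are close along the first one and the second field is Lipschitz. -/
theorem norm_seg_sub_le (hx : IsSolOn f φ T x) (hy : IsSolOn g φ T y) (hf : Continuous f)
    (hg : Continuous g) {ε K : ℝ} (hε : 0 ≤ ε) (hK : 0 ≤ K) (hT : 0 ≤ T)
    (hfg : ∀ t ∈ Icc 0 T, ‖f (seg Δ x t) - g (seg Δ y t)‖ ≤ ε + K * ‖seg Δ x t - seg Δ y t‖) :
    ∀ t ∈ Icc 0 T, ‖seg Δ x t - seg Δ y t‖ ≤ T * ε * Real.exp (K * t) := by
  have hxc := hx.cont
  have hyc := hy.cont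
  have hsx := continuous_seg (Δ := Δ) hxc
  have hsy := continuous_seg (Δ := Δ) hyc
  have hfx : Continuous fun s => f (seg Δ x s) := hf.comp hsx
  have hgy : Continuous fun s => g (seg Δ y s) := hg.comp hsy
  simp_rw [← seg_sub hxc hyc]
  refine norm_seg_le_mul_exp_of_norm_le_integral (by fun_prop) (by positivity) hK ?_ ?_
  · intro s hs
    rw [hx.init ⟨s, hs⟩, hy.init ⟨s, hs⟩, sub_self, norm_zero]
    positivity
  · intro t ht
    have h0 : x 0 = y 0 :=
      (hx.init ⟨0, zero_mem_IccD Δ⟩).trans (hy.init ⟨0, zero_mem_IccD Δ⟩).symm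
    have heq : x t - y t = ∫ s in (0 : ℝ)..t, (f (seg Δ x s) - g (seg Δ y s)) := by
      rw [intervalIntegral.integral_sub (hfx.intervalIntegrable _ _)
        (hgy.intervalIntegrable _ _), hx.integral_eq t ht, hy.integral_eq t ht, h0,
        add_sub_add_left_eq_sub]
    simp_rw [seg_sub hxc hyc]
    have hnc : Continuous fun s => ‖seg Δ x s - seg Δ y s‖ := (hsx.sub hsy).norm
    calc ‖x t - y t‖ ≤ ∫ s in (0 : ℝ)..t, (ε + K * ‖seg Δ x s - seg Δ y s‖) := by
          rw [heq]
          refine intervalIntegral.norm_integral_le_of_norm_le ht.1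
            (Eventually.of_forall fun s hs => hfg s ⟨hs.1.le, hs.2.trans ht.2⟩) ?_
          exact (continuous_const.add (hnc.const_mul K)).intervalIntegrable _ _
      _ = t * ε + K * ∫ s in (0 : ℝ)..t, ‖seg Δ x s - seg Δ y s‖ := by
          rw [intervalIntegral.integral_add intervalIntegrable_const
            ((hnc.const_mul K).intervalIntegrable _ _),
            intervalIntegral.integral_const_mul]
          simp
      _ ≤ T * ε + K * ∫ s in (0 : ℝ)..t, ‖seg Δ x s - seg Δ y s‖ := by
          gcongr
          exact ht.2

theorem norm_seg_le_mul_exp (hx : IsSolOn g φ T x) {K : ℝ≥0} (hg : LipschitzWith K g)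
    (hg0 : g 0 = 0) : ∀ t ∈ Icc 0 T, ‖seg Δ x t‖ ≤ ‖φ‖ * Real.exp (K * t) := by
  have hxc := hx.cont
  refine norm_seg_le_mul_exp_of_norm_le_integral hxc (norm_nonneg _) K.coe_nonneg
    (fun s hs => hx.norm_init_le hs) fun t ht => ?_
  rw [hx.integral_eq t ht]
  refine (norm_add_le _ _).trans (add_le_add (hx.norm_init_le (zero_mem_IccD Δ)) ?_)
  rw [← intervalIntegral.integral_const_mul]
  refine intervalIntegral.norm_integral_le_of_norm_le ht.1
    (Eventually.of_forall fun s _ => ?_)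
    (((continuous_seg hxc).norm.const_mul (K : ℝ)).intervalIntegrable _ _)
  simpa [hg0] using hg.norm_sub_le (seg Δ x s) 0

theorem eqOn (hf : LipOnBounded₀ f) (hfc : Continuous f) (hx : IsSolOn f φ T x)
    (hy : IsSolOn f φ T y) (hT : 0 ≤ T) : EqOn x y (Icc (-(Δ : ℝ)) T) := by
  have hxc := hx.cont
  have hyc := hy.cont
  have hsum : Continuous fun t => ‖seg Δ x t‖ + ‖seg Δ y t‖ :=
    (continuous_seg hxc).norm.add (continuous_seg hyc).norm
  obtain ⟨R, hR⟩ := (isCompact_Icc (a := 0) (b := T)).exists_bound_of_continuousOn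
    hsum.continuousOn
  obtain ⟨L, hL, hfL⟩ := hf (max R 1) (by positivity)
  have hbd (t : ℝ) (ht : t ∈ Icc 0 T) : ‖seg Δ x t‖ ≤ max R 1 ∧ ‖seg Δ y t‖ ≤ max R 1 := by
    have h := (Real.le_norm_self _).trans (hR t ht)
    have h1 := le_max_left R 1
    constructor <;> linarith [norm_nonneg (seg Δ x t), norm_nonneg (seg Δ y t)]
  have hclose := hx.norm_seg_sub_le hy hfc hfc le_rfl hL.le hT fun t ht => by
    rw [zero_add]
    exact hfL _ _ (hbd t ht).1 (hbd t ht).2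
  intro s hs
  rcases le_total s 0 with hs0 | hs0
  · exact (hx.init ⟨s, hs.1, hs0⟩).trans (hy.init ⟨s, hs.1, hs0⟩).symm
  · have h := hclose s ⟨hs0, hs.2⟩
    rw [mul_zero, zero_mul, ← seg_sub hxc hyc] at h
    have h' := (norm_apply_le_norm_seg (hxc.sub hyc) s).trans h
    exact sub_eq_zero.1 (norm_le_zero_iff.1 h')

end IsSolOn

theorem LipOnBounded₀.exists_lipschitzOnWith (hf : LipOnBounded₀ f) {r : ℝ} (hr : 0 < r) :
    ∃ K : ℝ≥0, LipschitzOnWith K f (Metric.closedBall 0 r) := by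
  obtain ⟨L, hL, hfL⟩ := hf r hr
  refine ⟨⟨L, hL.le⟩, LipschitzOnWith.of_dist_le_mul fun φ hφ ψ hψ => ?_⟩
  rw [dist_eq_norm, dist_eq_norm]
  exact hfL φ ψ (mem_closedBall_zero_iff.1 hφ) (mem_closedBall_zero_iff.1 hψ)

theorem LipOnBounded₀.continuous (hf : LipOnBounded₀ f) : Continuous f := by
  refine continuous_iff_continuousAt.2 fun φ => ?_
  obtain ⟨K, hK⟩ := hf.exists_lipschitzOnWith (r := ‖φ‖ + 1) (by positivity)
  exact hK.continuousOn.continuousAt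
    (Metric.closedBall_mem_nhds_of_mem (by simp))

theorem LipOnBounded₀.exists_lipschitzWith_eqOn (hf : LipOnBounded₀ f) {r : ℝ} (hr : 0 < r) :
    ∃ (K : ℝ≥0) (g : Hist Δ n → Vec n),
      LipschitzWith K g ∧ ∀ φ, ‖φ‖ ≤ r → g φ = f φ := by
  obtain ⟨K, hK⟩ := hf.exists_lipschitzOnWith hr
  obtain ⟨g, hg, hfg⟩ := hK.extend_finite_dimension
  exact ⟨_, g, hg, fun φ hφ => (hfg (mem_closedBall_zero_iff.2 hφ)).symm⟩

theorem ContinuousLinearMap.lipOnBounded₀ (A : Hist Δ n →L[ℝ] Vec n) :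
    LipOnBounded₀ fun φ => A φ := by
  refine fun _ _ => ⟨‖A‖ + 1, by positivity, fun φ ψ _ _ => ?_⟩
  rw [← map_sub]
  exact (A.le_opNorm _).trans (by gcongr; linarith)

end Solutions

/-! ### Global existence for globally Lipschitz fields -/

section Existence

variable {Δ : ℝ≥0} {n : ℕ}

theorem norm_exp_smul_integral_le {h : ℝ → Vec n} {M C t : ℝ} (hM : 0 < M) (hC : 0 ≤ C)
    (ht : 0 ≤ t) (hb : ∀ s ∈ Icc 0 t, ‖h s‖ ≤ C * Real.exp (M * s)) :
    ‖Real.exp (-(M * t)) • ∫ s in (0 : ℝ)..t, h s‖ ≤ C / M := by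
  have hcont : Continuous fun s => C * Real.exp (M * s) := by fun_prop
  have hexp : ∫ s in (0 : ℝ)..t, C * Real.exp (M * s) = C / M * (Real.exp (M * t) - 1) := by
    rw [intervalIntegral.integral_const_mul, intervalIntegral.integral_comp_mul_left _ hM.ne',
      integral_exp, mul_zero, Real.exp_zero, smul_eq_mul]
    ring
  have hint := intervalIntegral.norm_integral_le_of_norm_le ht
    (Eventually.of_forall fun s hs => hb s ⟨hs.1.le, hs.2⟩)
    (hcont.intervalIntegrable (μ := volume) _ _)
  rw [hexp] at hint
  rw [norm_smul, Real.norm_of_nonneg (Real.exp_pos _).le]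
  calc Real.exp (-(M * t)) * ‖∫ s in (0 : ℝ)..t, h s‖
      ≤ Real.exp (-(M * t)) * (C / M * Real.exp (M * t)) := by
        gcongr
        refine hint.trans ?_
        gcongr
        linarith
    _ = C / M := by
        rw [mul_left_comm, ← Real.exp_add, neg_add_cancel, Real.exp_zero, mul_one]

theorem norm_seg_exp_smul_le (w : BoundedContinuousFunction ℝ (Vec n)) {M s : ℝ} (hM : 0 ≤ M)
    (hs : 0 ≤ s) :
    ‖seg Δ (fun r => Real.exp (M * max r 0) • w r) s‖ ≤ ‖w‖ * Real.exp (M * s) := by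
  refine norm_seg_le (by fun_prop) (by positivity) fun r hr => ?_
  rw [norm_smul, Real.norm_of_nonneg (Real.exp_pos _).le, mul_comm]
  gcongr
  · exact w.norm_coe_le_norm r
  · exact max_le hr.2 hs

/-- The Picard operator is a contraction on bounded continuous functions once trajectories are
rescaled by an exponential weight. -/
theorem exists_isSolOn_of_lipschitzWith {g : Hist Δ n → Vec n} {K : ℝ≥0}
    (hg : LipschitzWith K g) (hg0 : g 0 = 0) (φ : Hist Δ n) :
    ∃ x : ℝ → Vec n, ∀ T, IsSolOn g φ T x := by
  let M : ℝ := 2 * (K + 1)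
  have hM : 0 < M := by positivity
  have hKM : (K : ℝ) / M ≤ 1 / 2 := by
    rw [div_le_div_iff₀ hM two_pos]
    simp only [M]
    linarith
  let W (w : BoundedContinuousFunction ℝ (Vec n)) (t : ℝ) : Vec n :=
    Real.exp (M * max t 0) • w t
  have hW (w) : Continuous (W w) := by fun_prop
  let P (w : BoundedContinuousFunction ℝ (Vec n)) (t : ℝ) : Vec n :=
    IccExtend (neg_nonpos.2 Δ.coe_nonneg) φ t + ∫ s in (0 : ℝ)..max t 0, g (seg Δ (W w) s)
  have hgW (w) : Continuous fun s => g (seg Δ (W w) s) :=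
    hg.continuous.comp (continuous_seg (hW w))
  have hP (w) : Continuous (P w) := by
    refine φ.continuous.Icc_extend'.add ?_
    exact (intervalIntegral.continuous_primitive (fun a b => (hgW w).intervalIntegrable (μ := volume) a b)
      0).comp (continuous_id.max continuous_const)
  have hbound (w) (t : ℝ) : ‖Real.exp (-(M * max t 0)) • P w t‖ ≤ ‖φ‖ + K * ‖w‖ / M := by
    rw [smul_add]
    refine (norm_add_le _ _).trans (add_le_add ?_ ?_)
    · rw [norm_smul, Real.norm_of_nonneg (Real.exp_pos _).le]
      refine (mul_le_of_le_one_left (norm_nonneg _) ?_).trans (φ.norm_coe_le_norm _)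
      rw [Real.exp_le_one_iff, neg_nonpos]
      positivity
    · refine norm_exp_smul_integral_le hM (by positivity) (le_max_right _ _) fun s hs => ?_
      have h := hg.norm_sub_le (seg Δ (W w) s) 0
      rw [hg0, sub_zero, sub_zero] at h
      rw [mul_assoc]
      exact h.trans (by gcongr; exact norm_seg_exp_smul_le w hM.le hs.1)
  let Φ (w : BoundedContinuousFunction ℝ (Vec n)) : BoundedContinuousFunction ℝ (Vec n) :=
    BoundedContinuousFunction.ofNormedAddCommGroup
      (fun t => Real.exp (-(M * max t 0)) • P w t) (by have := hP w; fun_prop) _ (hbound w)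
  have hΦ : ContractingWith (1 / 2) Φ := by
    refine ⟨by norm_num [← NNReal.coe_lt_coe], LipschitzWith.of_dist_le_mul fun v w => ?_⟩
    rw [BoundedContinuousFunction.dist_le (by positivity)]
    intro t
    have hsub : Φ v t - Φ w t = Real.exp (-(M * max t 0)) •
        ∫ s in (0 : ℝ)..max t 0, (g (seg Δ (W v) s) - g (seg Δ (W w) s)) := by
      rw [intervalIntegral.integral_sub ((hgW v).intervalIntegrable _ _)
        ((hgW w).intervalIntegrable _ _)]
      simp only [Φ, P, BoundedContinuousFunction.coe_ofNormedAddCommGroup]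
      rw [← smul_sub, add_sub_add_left_eq_sub]
    rw [dist_eq_norm, dist_eq_norm, hsub]
    have hle := norm_exp_smul_integral_le (M := M) (C := K * ‖v - w‖) (t := max t 0)
      (h := fun s => g (seg Δ (W v) s) - g (seg Δ (W w) s)) hM (by positivity)
      (le_max_right _ _) fun s hs => by
        have hseg : seg Δ (W v) s - seg Δ (W w) s = seg Δ (W (v - w)) s := by
          rw [← seg_sub (hW v) (hW w)]
          congr 1
          ext1 r
          simp only [W, BoundedContinuousFunction.sub_apply, smul_sub]
        rw [mul_assoc]
        refine (hg.norm_sub_le _ _).trans ?_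
        rw [hseg]
        gcongr
        exact norm_seg_exp_smul_le (v - w) hM.le hs.1
    refine hle.trans ?_
    rw [mul_div_right_comm]
    push_cast
    gcongr
  set w := ContractingWith.fixedPoint Φ hΦ
  have hfix : Φ w = w := hΦ.fixedPoint_isFixedPt
  have hWP : W w = P w := by
    ext1 t
    have h : Real.exp (-(M * max t 0)) • P w t = w t := congrArg (fun v => v t) hfix
    simp only [W]
    rw [← h, smul_smul, ← Real.exp_add, add_neg_cancel, Real.exp_zero, one_smul]
  have hinit (τ : Icc (-(Δ : ℝ)) (0 : ℝ)) : W w τ = φ τ := by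
    rw [hWP]
    simp only [P]
    rw [IccExtend_val, max_eq_right τ.2.2, intervalIntegral.integral_same, add_zero]
  refine ⟨W w, fun T => ⟨hW w, hinit, fun t ht => ?_⟩⟩
  rw [hinit ⟨0, zero_mem_IccD Δ⟩, congrFun hWP t]
  simp only [P]
  rw [max_eq_left ht.1, IccExtend_of_right_le _ _ ht.1]

end Existence

/-! ### Maximal solutions -/

section MaxSolutions

variable {Δ : ℝ≥0} {n : ℕ} {f : Hist Δ n → Vec n} {φ : Hist Δ n} {M : EReal} {x z : ℝ → Vec n}

theorem isSolution₀_iff (hf : Continuous f) :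
    IsSolution₀ Δ f φ M x ↔ 0 < M ∧ ∀ T : ℝ, 0 ≤ T → (T : EReal) < M →
      ∃ y, IsSolOn f φ T y ∧ EqOn x y (Icc (-(Δ : ℝ)) T) := by
  have hΔ := Δ.coe_nonneg
  have hseg {y : ℝ → Vec n} {T : ℝ} (h : EqOn x y (Icc (-(Δ : ℝ)) T)) (s : ℝ)
      (hs : s ∈ Icc 0 T) : seg Δ x s = seg Δ y s :=
    seg_congr (h.mono (Icc_subset_Icc (by linarith [hs.1]) hs.2))
  constructor
  · refine fun h => ⟨h.tmax_pos, fun T hT hTM => ?_⟩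
    have hle : -(Δ : ℝ) ≤ T := by linarith
    have hxc : ContinuousOn x (Icc (-(Δ : ℝ)) T) := h.cont.mono fun s hs =>
      ⟨hs.1, (EReal.coe_le_coe_iff.2 hs.2).trans_lt hTM⟩
    have heq : EqOn x (IccExtend hle ((Icc (-(Δ : ℝ)) T).domRestrict x)) (Icc (-(Δ : ℝ)) T) :=
      fun s hs => by rw [IccExtend_of_mem _ _ hs, domRestrict_apply]
    refine ⟨_, ⟨hxc.domRestrict.Icc_extend', fun τ => ?_, fun t ht => ?_⟩, heq⟩
    · rw [← heq ⟨τ.2.1, τ.2.2.trans hT⟩, h.init]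
    · rw [← heq ⟨by linarith [ht.1], ht.2⟩, ← heq ⟨by linarith, hT⟩, h.integral_eq t ht.1
        ((EReal.coe_le_coe_iff.2 ht.2).trans_lt hTM)]
      congr 1
      refine intervalIntegral.integral_congr fun s hs => ?_
      rw [uIcc_of_le ht.1] at hs
      exact congrArg f (hseg heq s ⟨hs.1, hs.2.trans ht.2⟩)
  · rintro ⟨hM, h⟩
    refine ⟨hM, ?_, fun τ => ?_, fun t ht htM => ?_, fun t ht htM => ?_⟩
    · rintro s ⟨hs, hsM⟩
      obtain ⟨T, hT, hTM⟩ := EReal.lt_iff_exists_real_btwn.1 (max_lt hsM hM)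
      obtain ⟨hsT, h0T⟩ := max_lt_iff.1 hT
      rw [EReal.coe_lt_coe_iff] at hsT
      obtain ⟨y, hy, hxy⟩ := h T (by exact_mod_cast h0T.le) hTM
      refine hy.cont.continuousWithinAt.congr_of_eventuallyEq ?_ (hxy ⟨hs, hsT.le⟩)
      filter_upwards [self_mem_nhdsWithin, mem_nhdsWithin_of_mem_nhds (Iio_mem_nhds hsT)]
        with r hr hrT
      exact hxy ⟨hr.1, hrT.le⟩
    · obtain ⟨y, hy, hxy⟩ := h 0 le_rfl hM
      rw [hxy τ.2, hy.init]
    · obtain ⟨y, hy, hxy⟩ := h t ht htM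
      have hc : Continuous fun s => f (seg Δ y s) := hf.comp (continuous_seg hy.cont)
      refine (hc.intervalIntegrable 0 t).congr fun s hs => ?_
      rw [uIoc_of_le ht] at hs
      exact congrArg f (hseg hxy s ⟨hs.1.le, hs.2⟩).symm
    · obtain ⟨y, hy, hxy⟩ := h t ht htM
      rw [hxy ⟨by linarith, le_rfl⟩, hxy ⟨by linarith, ht⟩, hy.integral_eq t ⟨ht, le_rfl⟩]
      congr 1
      refine intervalIntegral.integral_congr fun s hs => ?_
      rw [uIcc_of_le ht] at hs
      exact congrArg f (hseg hxy s hs).symm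

theorem isMaxSolution₀_top (hf : Continuous f) (h : ∀ T, IsSolOn f φ T x) :
    IsMaxSolution₀ Δ f φ ⊤ x :=
  ⟨(isSolution₀_iff hf).2 ⟨EReal.zero_lt_top, fun T _ _ => ⟨x, h T, eqOn_refl _ _⟩⟩,
    fun _ _ _ _ => le_top⟩

theorem IsSolution₀.eq_of_lt (hf : LipOnBounded₀ f) {M' : EReal} (hx : IsSolution₀ Δ f φ M x)
    (hz : IsSolution₀ Δ f φ M' z) {t : ℝ} (ht : -(Δ : ℝ) ≤ t) (htM : (t : EReal) < M)
    (htM' : (t : EReal) < M') : x t = z t := by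
  obtain ⟨hM, hx⟩ := (isSolution₀_iff hf.continuous).1 hx
  obtain ⟨hM', hz⟩ := (isSolution₀_iff hf.continuous).1 hz
  have hT : ((max t 0 : ℝ) : EReal) = max (t : EReal) 0 := by
    rw [EReal.coe_strictMono.monotone.map_max, EReal.coe_zero]
  obtain ⟨y, hy, hxy⟩ := hx (max t 0) (le_max_right _ _) (hT ▸ max_lt htM hM)
  obtain ⟨v, hv, hzv⟩ := hz (max t 0) (le_max_right _ _) (hT ▸ max_lt htM' hM')
  have hmem : t ∈ Icc (-(Δ : ℝ)) (max t 0) := ⟨ht, le_max_left _ _⟩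
  rw [hxy hmem, hzv hmem, hy.eqOn hf hf.continuous hv (le_max_right _ _) hmem]

theorem IsMaxSolution₀.eq_top_and_eq (hf : LipOnBounded₀ f) (hx : IsMaxSolution₀ Δ f φ M x)
    (hz : ∀ T, IsSolOn f φ T z) : M = ⊤ ∧ ∀ t : ℝ, 0 ≤ t → x t = z t := by
  have hz' := isMaxSolution₀_top hf.continuous hz
  have hM : M = ⊤ := top_le_iff.1 <| hx.2 ⊤ z hz'.1 fun t ht htM =>
    IsSolution₀.eq_of_lt hf hz'.1 hx.1 ht (EReal.coe_lt_top t) htM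
  refine ⟨hM, fun t ht => IsSolution₀.eq_of_lt hf hx.1 hz'.1 ?_ ?_ (EReal.coe_lt_top t)⟩
  · linarith [Δ.coe_nonneg]
  · exact hM ▸ EReal.coe_lt_top t

theorem exists_isSolution₀ (hf : LipOnBounded₀ f) (hf0 : f 0 = 0) (φ : Hist Δ n) :
    ∃ M x, IsSolution₀ Δ f φ M x := by
  obtain ⟨K, g, hg, hgf⟩ := hf.exists_lipschitzWith_eqOn (r := ‖φ‖ + 1) (by positivity)
  obtain ⟨z, hz⟩ := exists_isSolOn_of_lipschitzWith hg
    ((hgf 0 (by rw [norm_zero]; positivity)).trans hf0) φ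
  have hnear : ∀ᶠ t in 𝓝 (0 : ℝ), ‖seg Δ z t‖ < ‖φ‖ + 1 :=
    (continuous_seg (hz 0).cont).norm.continuousAt.eventually_lt_const
      (by simp only [(hz 0).seg_zero, lt_add_one])
  obtain ⟨η, hη, hball⟩ := Metric.eventually_nhds_iff.1 hnear
  refine ⟨(η : ℝ), z, (isSolution₀_iff hf.continuous).2
    ⟨by exact_mod_cast hη, fun T _ hTη => ⟨z, ?_, eqOn_refl _ _⟩⟩⟩
  refine (hz T).congr_field fun t ht => (hgf _ (hball ?_).le).symm
  rw [Real.dist_0_eq_abs, abs_of_nonneg ht.1]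
  exact ht.2.trans_lt (EReal.coe_lt_coe_iff.1 hTη)

/-- The maximal solution is obtained by gluing all solutions with the given initial state. -/
theorem exists_isMaxSolution₀ (hf : LipOnBounded₀ f) (hf0 : f 0 = 0) (φ : Hist Δ n) :
    ∃ M x, IsMaxSolution₀ Δ f φ M x := by
  classical
  let S : Set EReal := {M | ∃ x, IsSolution₀ Δ f φ M x}
  have hex (t : ℝ) (ht : (t : EReal) < sSup S) :
      ∃ M y, IsSolution₀ Δ f φ M y ∧ (t : EReal) < M := by
    obtain ⟨M, ⟨y, hy⟩, htM⟩ := lt_sSup_iff.1 ht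
    exact ⟨M, y, hy, htM⟩
  choose! M y hy hM using hex
  refine ⟨sSup S, fun t => y t t, ?_, fun M' x' hx' _ => le_sSup ⟨x', hx'⟩⟩
  refine (isSolution₀_iff hf.continuous).2 ⟨?_, fun T hT hTS => ?_⟩
  · obtain ⟨M₀, x₀, h₀⟩ := exists_isSolution₀ hf hf0 φ
    exact h₀.tmax_pos.trans_le (le_sSup ⟨x₀, h₀⟩)
  · obtain ⟨v, hv, hyv⟩ := ((isSolution₀_iff hf.continuous).1 (hy T hTS)).2 T hT (hM T hTS)
    refine ⟨v, hv, fun s hs => ?_⟩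
    have hsT : (s : EReal) ≤ T := EReal.coe_le_coe_iff.2 hs.2
    have hsS := hsT.trans_lt hTS
    rw [← hyv hs]
    exact IsSolution₀.eq_of_lt hf (hy s hsS) (hy T hTS) hs.1 (hM s hsS)
      (hsT.trans_lt (hM T hTS))

end MaxSolutions

/-! ### Comparison with the linearization and exponential decay -/

section Decay

variable {Δ : ℝ≥0} {n : ℕ}

theorem exists_norm_seg_sub_le_of_linearization {f : Hist Δ n → Vec n} (hf : Continuous f)
    {A : Hist Δ n →L[ℝ] Vec n}
    (hA : ∀ ε : ℝ, 0 < ε → ∃ δ : ℝ, 0 < δ ∧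
      ∀ φ : Hist Δ n, ‖φ‖ ≤ δ → ‖f φ - A φ‖ ≤ ε * ‖φ‖)
    {T C : ℝ} (hT : 0 < T) (hC : 0 < C) :
    ∃ δ : ℝ, 0 < δ ∧ ∀ (φ : Hist Δ n) (x y : ℝ → Vec n), ‖φ‖ ≤ δ → IsSolOn f φ T x →
      IsSolOn (fun ψ => A ψ) φ T y → (∀ t ∈ Icc 0 T, ‖seg Δ x t‖ ≤ C * ‖φ‖) →
        ‖seg Δ x T - seg Δ y T‖ ≤ ‖φ‖ / 4 := by
  have hexp := Real.exp_pos (‖A‖ * T)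
  obtain ⟨δ, hδ, hfA⟩ := hA (1 / (4 * (T * C * Real.exp (‖A‖ * T)))) (by positivity)
  refine ⟨δ / C, by positivity, fun φ x y hφ hx hy hbd => ?_⟩
  rw [le_div_iff₀' hC] at hφ
  refine (hx.norm_seg_sub_le hy hf A.continuous
    (ε := 1 / (4 * (T * C * Real.exp (‖A‖ * T))) * (C * ‖φ‖)) (K := ‖A‖)
    (by positivity) (norm_nonneg A) hT.le (fun t ht => ?_) T ⟨hT.le, le_rfl⟩).trans_eq ?_
  · calc ‖f (seg Δ x t) - A (seg Δ y t)‖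
        ≤ ‖f (seg Δ x t) - A (seg Δ x t)‖ + ‖A (seg Δ x t - seg Δ y t)‖ := by
          rw [map_sub]
          exact norm_sub_le_norm_sub_add_norm_sub _ _ _
      _ ≤ 1 / (4 * (T * C * Real.exp (‖A‖ * T))) * (C * ‖φ‖)
          + ‖A‖ * ‖seg Δ x t - seg Δ y t‖ := by
          refine add_le_add ((hfA _ ((hbd t ht).trans hφ)).trans ?_) (A.le_opNorm _)
          gcongr
          exact hbd t ht
  · field_simp

/-- If trajectories starting in a ball are halved after time `T`, they decay exponentially. -/
theorem norm_seg_le_exp_of_contraction {g : Hist Δ n → Vec n} (hg : Continuous g)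
    {T C δ : ℝ} (hT : 0 < T) (hC : 0 ≤ C)
    (hstep : ∀ (φ : Hist Δ n) (x : ℝ → Vec n), ‖φ‖ ≤ δ → (∀ S, IsSolOn g φ S x) →
      (∀ t ∈ Icc 0 T, ‖seg Δ x t‖ ≤ C * ‖φ‖) ∧ ‖seg Δ x T‖ ≤ ‖φ‖ / 2)
    {φ : Hist Δ n} {x : ℝ → Vec n} (hφ : ‖φ‖ ≤ δ) (hx : ∀ S, IsSolOn g φ S x) {t : ℝ}
    (ht : 0 ≤ t) : ‖seg Δ x t‖ ≤ 2 * C * ‖φ‖ * Real.exp (-(Real.log 2 / T) * t) := by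
  have hxc := (hx 0).cont
  have hiter (m : ℕ) : ‖seg Δ x (m * T)‖ ≤ ‖φ‖ * (1 / 2) ^ m := by
    induction m with
    | zero => simp [(hx 0).seg_zero]
    | succ m ih =>
      have hle : ‖seg Δ x (m * T)‖ ≤ δ := ih.trans <|
        (mul_le_of_le_one_right (norm_nonneg _)
          (pow_le_one₀ (by norm_num) (by norm_num))).trans hφ
      have h := (hstep _ _ hle (IsSolOn.shift hx hg (by positivity))).2
      rw [seg_shift hxc] at h
      have hm : ((m + 1 : ℕ) : ℝ) * T = m * T + T := by push_cast; ring
      rw [hm, pow_succ]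
      linarith
  set m := ⌊t / T⌋₊
  have hm : m * T ≤ t := (le_div_iff₀ hT).1 (Nat.floor_le (by positivity))
  have hm' : t < (m + 1) * T := (div_lt_iff₀ hT).1 (Nat.lt_floor_add_one _)
  have hle : ‖seg Δ x (m * T)‖ ≤ δ := (hiter m).trans <|
    (mul_le_of_le_one_right (norm_nonneg _)
      (pow_le_one₀ (by norm_num) (by norm_num))).trans hφ
  have h := (hstep _ _ hle (IsSolOn.shift hx hg (by positivity))).1 (t - m * T)
    ⟨by linarith, by linarith⟩
  rw [seg_shift hxc, add_sub_cancel] at h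
  have hpow : ((1 : ℝ) / 2) ^ (m + 1) ≤ Real.exp (-(Real.log 2 / T) * t) := by
    have hlog : ((1 : ℝ) / 2) ^ (m + 1) = Real.exp (-Real.log 2 * (m + 1)) := by
      rw [mul_comm, ← Nat.cast_add_one, Real.exp_nat_mul, Real.exp_neg,
        Real.exp_log two_pos, one_div]
    rw [hlog, Real.exp_le_exp]
    have hlog2 := Real.log_pos one_lt_two
    have hdiv : t / T ≤ m + 1 := by
      rw [div_le_iff₀ hT]
      exact hm'.le
    calc -Real.log 2 * (m + 1) ≤ -Real.log 2 * (t / T) := by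
          rw [neg_mul, neg_mul, neg_le_neg_iff]
          gcongr
      _ = -(Real.log 2 / T) * t := by ring
  calc ‖seg Δ x t‖ ≤ C * (‖φ‖ * (1 / 2) ^ m) := h.trans (by gcongr; exact hiter m)
    _ = 2 * C * ‖φ‖ * (1 / 2) ^ (m + 1) := by ring
    _ ≤ 2 * C * ‖φ‖ * Real.exp (-(Real.log 2 / T) * t) := by gcongr

theorem classKL_mul_exp {k lam : ℝ} (hk : 0 < k) (hlam : 0 < lam) :
    ClassKL fun s t => k * s * Real.exp (-lam * t) := by
  refine ⟨fun t _ => ⟨by fun_prop, fun a _ b _ hab => ?_, by simp⟩,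
    fun s hs => ⟨by fun_prop, fun a _ b _ hab => ?_, ?_⟩⟩
  · have := Real.exp_pos (-lam * t)
    dsimp only
    gcongr
  · have : -lam * b ≤ -lam * a := by nlinarith
    dsimp only
    gcongr
  · have h : Tendsto (fun t => -lam * t) atTop atBot :=
      tendsto_id.const_mul_atTop_of_neg (neg_neg_of_pos hlam)
    simpa using (Real.tendsto_exp_atBot.comp h).const_mul (k * s)

theorem AS.exists_norm_seg_le_div_four {A : Hist Δ n →L[ℝ] Vec n} (h : AS Δ fun φ => A φ) :
    ∃ T : ℝ, 0 < T ∧ ∀ (φ : Hist Δ n) (y : ℝ → Vec n),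
      (∀ S, IsSolOn (fun ψ => A ψ) φ S y) → ‖seg Δ y T‖ ≤ ‖φ‖ / 4 := by
  obtain ⟨r, hr, β, hβ, hAS⟩ := h
  obtain ⟨t₀, ht₀⟩ := eventually_atTop.1
    ((hβ.2 r hr.le).2.2.eventually_le_const (by positivity : 0 < r / 4))
  have hΔ := Δ.coe_nonneg
  have hT₀ := le_max_right t₀ 0
  have ht₀' := le_max_left t₀ 0
  refine ⟨max t₀ 0 + Δ + 1, by linarith, fun φ y hy => ?_⟩
  have hyc := (hy 0).cont
  rcases eq_or_ne φ 0 with rfl | hφ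
  · have h := (hy _).norm_seg_le_mul_exp A.lipschitz (map_zero A) (max t₀ 0 + Δ + 1)
      ⟨by linarith, le_rfl⟩
    simpa using h
  · have hpos : 0 < ‖φ‖ := norm_pos_iff.2 hφ
    have hnorm : ‖(r / ‖φ‖) • φ‖ = r := by
      rw [norm_smul, Real.norm_of_nonneg (by positivity), div_mul_cancel₀ _ hpos.ne']
    have hsol := (hAS _ _ _ (isMaxSolution₀_top A.continuous
      fun S => (hy S).const_smul (r / ‖φ‖)) hnorm.le).2
    rw [hnorm] at hsol
    refine norm_seg_le hyc (by positivity) fun s hs => ?_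
    have hs' := (hsol s (by linarith [hs.1])).trans (ht₀ s (by linarith [hs.1]))
    rw [norm_smul, Real.norm_of_nonneg (by positivity), div_mul_eq_mul_div,
      div_le_iff₀ hpos] at hs'
    exact le_of_mul_le_mul_left (hs'.trans_eq (by ring)) hr

end Decay

theorem ES_of_linearization_AS {Δ : ℝ≥0} {n : ℕ} {f₀ : Hist Δ n → Vec n}
    (hf : LipOnBounded₀ f₀) (hf0 : f₀ 0 = 0) {A : Hist Δ n →L[ℝ] Vec n}
    (hFrechet : ∀ ε : ℝ, 0 < ε → ∃ δ : ℝ, 0 < δ ∧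
      ∀ φ : Hist Δ n, ‖φ‖ ≤ δ → ‖f₀ φ - A φ‖ ≤ ε * ‖φ‖)
    (hAS : AS Δ fun φ => A φ) : ES Δ f₀ := by
  obtain ⟨T, hT, hlin⟩ := AS.exists_norm_seg_le_div_four hAS
  obtain ⟨K, g, hg, hgf⟩ := hf.exists_lipschitzWith_eqOn one_pos
  have hg0 : g 0 = 0 := (hgf 0 (by simp)).trans hf0
  set C := Real.exp (K * T)
  have hC : 1 ≤ C := Real.one_le_exp (by positivity)
  obtain ⟨δ, hδ, hcomp⟩ :=
    exists_norm_seg_sub_le_of_linearization hf.continuous hFrechet hT (one_pos.trans_le hC)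
  have hsmall {φ : Hist Δ n} (hφ : ‖φ‖ ≤ min δ (1 / (2 * C))) : 2 * C * ‖φ‖ ≤ 1 :=
    (le_div_iff₀' (by positivity)).1 (hφ.trans (min_le_right _ _))
  have hstep (φ : Hist Δ n) (x : ℝ → Vec n) (hφ : ‖φ‖ ≤ min δ (1 / (2 * C)))
      (hx : ∀ S, IsSolOn g φ S x) :
      (∀ t ∈ Icc 0 T, ‖seg Δ x t‖ ≤ C * ‖φ‖) ∧ ‖seg Δ x T‖ ≤ ‖φ‖ / 2 := by
    have hbd (t : ℝ) (ht : t ∈ Icc 0 T) : ‖seg Δ x t‖ ≤ C * ‖φ‖ := by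
      refine ((hx T).norm_seg_le_mul_exp hg hg0 t ht).trans ?_
      rw [mul_comm]
      gcongr
      exact Real.exp_le_exp.2 (mul_le_mul_of_nonneg_left ht.2 K.coe_nonneg)
    refine ⟨hbd, ?_⟩
    obtain ⟨y, hy⟩ := exists_isSolOn_of_lipschitzWith A.lipschitz (map_zero A) φ
    have hxf : IsSolOn f₀ φ T x := (hx T).congr_field fun t ht =>
      (hgf _ (by linarith [hbd t ht, hsmall hφ, norm_nonneg (seg Δ x t)])).symm
    have h1 := hcomp φ x y (hφ.trans (min_le_left _ _)) hxf (hy T) hbd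
    have h2 := hlin φ y hy
    have h3 := norm_le_norm_sub_add (seg Δ x T) (seg Δ y T)
    linarith
  have hlog : 0 < Real.log 2 / T := div_pos (Real.log_pos one_lt_two) hT
  refine ⟨min δ (1 / (2 * C)), by positivity, 2 * C, by linarith, Real.log 2 / T, hlog,
    fun φ M x hx hφ => ?_⟩
  obtain ⟨z, hz⟩ := exists_isSolOn_of_lipschitzWith hg hg0 φ
  have hdecay {t : ℝ} (ht : 0 ≤ t) :=
    norm_seg_le_exp_of_contraction hg.continuous hT (by positivity) hstep hφ hz ht
  have hzf (S : ℝ) : IsSolOn f₀ φ S z := (hz S).congr_field fun t ht => by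
    refine (hgf _ ((hdecay ht.1).trans ?_)).symm
    refine (mul_le_of_le_one_right (by positivity) ?_).trans (hsmall hφ)
    rw [Real.exp_le_one_iff, neg_mul, neg_nonpos]
    exact mul_nonneg hlog.le ht.1
  obtain ⟨hM, hxz⟩ := hx.eq_top_and_eq hf hzf
  refine ⟨hM, fun t ht => ?_⟩
  rw [hxz t ht]
  exact (norm_apply_le_norm_seg (hz 0).cont t).trans (hdecay ht)

theorem linearization_AS_of_ES {Δ : ℝ≥0} {n : ℕ} {f₀ : Hist Δ n → Vec n}
    (hf : LipOnBounded₀ f₀) (hf0 : f₀ 0 = 0) {A : Hist Δ n →L[ℝ] Vec n}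
    (hFrechet : ∀ ε : ℝ, 0 < ε → ∃ δ : ℝ, 0 < δ ∧
      ∀ φ : Hist Δ n, ‖φ‖ ≤ δ → ‖f₀ φ - A φ‖ ≤ ε * ‖φ‖)
    (hES : ES Δ f₀) : AS Δ fun φ => A φ := by
  obtain ⟨r, hr, k, hk, lam, hlam, hsol⟩ := hES
  have hΔ := Δ.coe_nonneg
  have hk0 : 0 < k := one_pos.trans_le hk
  have htend := ((classKL_mul_exp hk0 hlam).2 1 zero_le_one).2.2
  obtain ⟨t₀, ht₀⟩ := eventually_atTop.1
    (htend.eventually_le_const (by norm_num : (0 : ℝ) < 1 / 4))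
  have hT₀ := le_max_right t₀ 0
  have ht₀' := le_max_left t₀ 0
  set T := max t₀ 0 + Δ + 1
  have hT : 0 < T := by linarith
  obtain ⟨δ, hδ, hcomp⟩ :=
    exists_norm_seg_sub_le_of_linearization hf.continuous hFrechet hT hk0
  set C := Real.exp (‖A‖ * T)
  have hC : 0 < C := Real.exp_pos _
  have hstep (φ : Hist Δ n) (y : ℝ → Vec n) (hφ : ‖φ‖ ≤ min δ r)
      (hy : ∀ S, IsSolOn (fun ψ => A ψ) φ S y) :
      (∀ t ∈ Icc 0 T, ‖seg Δ y t‖ ≤ C * ‖φ‖) ∧ ‖seg Δ y T‖ ≤ ‖φ‖ / 2 := by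
    constructor
    · intro t ht
      refine ((hy T).norm_seg_le_mul_exp A.lipschitz (map_zero A) t ht).trans ?_
      rw [mul_comm, coe_nnnorm]
      gcongr
      exact Real.exp_le_exp.2 (mul_le_mul_of_nonneg_left ht.2 (norm_nonneg _))
    obtain ⟨M, x', hx'⟩ := exists_isMaxSolution₀ hf hf0 φ
    obtain ⟨rfl, hdecay⟩ := hsol φ M x' hx' (hφ.trans (min_le_right _ _))
    obtain ⟨x, hx, hxx'⟩ :=
      ((isSolution₀_iff hf.continuous).1 hx'.1).2 T hT.le (EReal.coe_lt_top T)
    have hxdecay (s : ℝ) (hs : s ∈ Icc 0 T) : ‖x s‖ ≤ k * ‖φ‖ * Real.exp (-lam * s) := by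
      rw [← hxx' ⟨by linarith [hs.1], hs.2⟩]
      exact hdecay s hs.1
    have hbd (t : ℝ) (ht : t ∈ Icc 0 T) : ‖seg Δ x t‖ ≤ k * ‖φ‖ := by
      refine norm_seg_le hx.cont (by positivity) fun s hs => ?_
      rcases le_total s 0 with hs0 | hs0
      · exact (hx.norm_init_le ⟨by linarith [hs.1, ht.1], hs0⟩).trans
          (le_mul_of_one_le_left (norm_nonneg _) hk)
      · refine (hxdecay s ⟨hs0, hs.2.trans ht.2⟩).trans
          (mul_le_of_le_one_right (by positivity) ?_)
        rw [Real.exp_le_one_iff, neg_mul, neg_nonpos]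
        positivity
    have hxT : ‖seg Δ x T‖ ≤ ‖φ‖ / 4 := by
      refine norm_seg_le hx.cont (by positivity) fun s hs => ?_
      refine (hxdecay s ⟨by linarith [hs.1], hs.2⟩).trans ?_
      have h := mul_le_mul_of_nonneg_left (ht₀ s (by linarith [hs.1])) (norm_nonneg φ)
      linarith
    have h1 := hcomp φ x y (hφ.trans (min_le_left _ _)) hx (hy T) hbd
    have h2 := norm_le_norm_sub_add (seg Δ y T) (seg Δ x T)
    rw [norm_sub_rev] at h2
    linarith
  have hlog : 0 < Real.log 2 / T := div_pos (Real.log_pos one_lt_two) hT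
  refine ⟨min δ r, lt_min hδ hr, _, classKL_mul_exp (by positivity : 0 < 2 * C) hlog,
    fun φ M x hx hφ => ?_⟩
  obtain ⟨y, hy⟩ := exists_isSolOn_of_lipschitzWith A.lipschitz (map_zero A) φ
  obtain ⟨hM, hxy⟩ := hx.eq_top_and_eq A.lipOnBounded₀ hy
  refine ⟨hM, fun t ht => ?_⟩
  rw [hxy t ht]
  exact (norm_apply_le_norm_seg (hy 0).cont t).trans
    (norm_seg_le_exp_of_contraction A.continuous hT hC.le hstep hφ hy ht)

/-- ES through linearization: if `f₀` is Fréchet differentiable at the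
origin with derivative `A`, then the origin of the nonlinear system is ES iff the origin of
the linear system `ẋ = A x_t` is AS. -/
theorem es_iff_linearization_as
    (Δ : ℝ≥0) (n : ℕ) (f₀ : Hist Δ n → Vec n)
    (hf : LipOnBounded₀ f₀) (hf0 : f₀ 0 = 0)
    (A : Hist Δ n →L[ℝ] Vec n)
    (hFrechet : ∀ ε : ℝ, 0 < ε → ∃ δ : ℝ, 0 < δ ∧
      ∀ φ : Hist Δ n, ‖φ‖ ≤ δ → ‖f₀ φ - A φ‖ ≤ ε * ‖φ‖) :
    ES Δ f₀ ↔ AS Δ (fun φ => A φ) := by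
  exact ⟨linearization_AS_of_ES hf hf0 hFrechet, ES_of_linearization_AS hf hf0 hFrechet⟩
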